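/- Let N ≥ 2, and for each receiver k let ψ_k ≥ 0, ϱ_k ≥ 0, q_k ∈ [0,1] with the constraint that whenever ψ_k > 0 one has ϱ_k ≥ ϱ_k − ψ_k + 1 (i.e., ψ_k ≥ 1) and ψ_k ≥ q_k. Fix receiver i with q_i ∈ [0,1], ϱ_i ≥ 0. Define Φ_{ik}(x) = (q_k/N)·(1 + (ϱ_k − ψ_k + 1)(ϱ_i + x)/(N−1)), Λ_{ik}(x) = q_k·ψ_k·(ϱ_i + x)/(N(N−1)), ξ_k = ψ_k·ϱ_k/(N(N−1)). Let T_ρ, T_σ be disjoint finite sets of receivers (not containing i) with ψ_k ≥ 1 and ψ_k ≥ q_k for all k in T_ρ. Define α_i = ∑_{k≠i} q_i·ξ_k − ∑_{k∈T_ρ} Φ_{ik}(q_i) + ∑_{k∈T_σ} Λ_{ik}(q_i) and β_i = −∑_{k∈T_ρ} Φ_{ik}(0) + ∑_{k∈T_σ} Λ_{ik}(0), where the first sum in α_i ranges over all receivers k ≠ i in the union of T_ρ, T_σ and a remaining set T_c. Then α_i ≥ β_i. -/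

import Mathlib

/-- Theorem 3 of the paper: the increase `α i` in the expected degree of a
receiver's remaining vertices when it is targeted is at least the increase
`β i` when it is not targeted. -/
theorem alpha_ge_beta {ι : Type*} [DecidableEq ι] (N : ℕ) (hN : 2 ≤ N)
    (Tρ Tσ Tc : Finset ι) (hρσ : Disjoint Tρ Tσ) (hρc : Disjoint Tρ Tc)
    (hσc : Disjoint Tσ Tc)
    (i : ι) (hiρ : i ∉ Tρ) (hiσ : i ∉ Tσ) (hic : i ∉ Tc)
    (ψ ϱ q : ι → ℝ)
    (hψ : ∀ k, 0 ≤ ψ k) (hϱ : ∀ k, 0 ≤ ϱ k)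
    (hq : ∀ k, 0 ≤ q k ∧ q k ≤ 1)
    (hTρ : ∀ k ∈ Tρ, 1 ≤ ψ k ∧ q k ≤ ψ k) :
    (- ∑ k ∈ Tρ, q k / N * (1 + (ϱ k - ψ k + 1) * (ϱ i + 0) / (N - 1))
      + ∑ k ∈ Tσ, q k * ψ k * (ϱ i + 0) / (N * (N - 1))) ≤
    (∑ k ∈ Tρ ∪ Tσ ∪ Tc, q i * (ψ k * ϱ k / (N * (N - 1)))
      - ∑ k ∈ Tρ, q k / N * (1 + (ϱ k - ψ k + 1) * (ϱ i + q i) / (N - 1))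
      + ∑ k ∈ Tσ, q k * ψ k * (ϱ i + q i) / (N * (N - 1))) := by
  have hN2 : (2 : ℝ) ≤ N := by exact_mod_cast hN
  have hN0 : (0 : ℝ) < N := by linarith
  have hN1 : (0 : ℝ) < (N : ℝ) - 1 := by linarith
  have hNN : (0 : ℝ) < (N : ℝ) * ((N : ℝ) - 1) := mul_pos hN0 hN1
  have hqi := (hq i).1
  have hsub : ∑ k ∈ Tρ, q i * (ψ k * ϱ k / (N * ((N : ℝ) - 1))) ≤
      ∑ k ∈ Tρ ∪ Tσ ∪ Tc, q i * (ψ k * ϱ k / (N * ((N : ℝ) - 1))) := by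
    apply Finset.sum_le_sum_of_subset_of_nonneg
    · intro k hk
      simp [hk]
    · intro k _ _
      exact mul_nonneg hqi (div_nonneg (mul_nonneg (hψ k) (hϱ k)) hNN.le)
  have hσ : ∑ k ∈ Tσ, q k * ψ k * (ϱ i + 0) / (N * ((N : ℝ) - 1)) ≤
      ∑ k ∈ Tσ, q k * ψ k * (ϱ i + q i) / (N * ((N : ℝ) - 1)) := by
    apply Finset.sum_le_sum
    intro k _
    have := mul_nonneg (hq k).1 (hψ k)
    gcongr
  have hρ : ∑ k ∈ Tρ, q k / N * (1 + (ϱ k - ψ k + 1) * (ϱ i + q i) / ((N : ℝ) - 1)) ≤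
      ∑ k ∈ Tρ, q k / N * (1 + (ϱ k - ψ k + 1) * (ϱ i + 0) / ((N : ℝ) - 1)) +
      ∑ k ∈ Tρ, q i * (ψ k * ϱ k / (N * ((N : ℝ) - 1))) := by
    rw [← Finset.sum_add_distrib]
    apply Finset.sum_le_sum
    intro k hk
    obtain ⟨h1, h2⟩ := hTρ k hk
    have key : 0 ≤ ψ k * ϱ k - q k * (ϱ k - ψ k + 1) := by
      nlinarith [mul_nonneg (sub_nonneg.2 h2) (hϱ k), mul_nonneg (hq k).1 (sub_nonneg.2 h1)]
    have h3 := div_nonneg (mul_nonneg hqi key) hNN.le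
    have e : q k / N * (1 + (ϱ k - ψ k + 1) * (ϱ i + 0) / ((N : ℝ) - 1)) +
        q i * (ψ k * ϱ k / (N * ((N : ℝ) - 1))) -
        q k / N * (1 + (ϱ k - ψ k + 1) * (ϱ i + q i) / ((N : ℝ) - 1)) =
        q i * (ψ k * ϱ k - q k * (ϱ k - ψ k + 1)) / (N * ((N : ℝ) - 1)) := by
      have := hN0.ne'
      have := hN1.ne'
      field_simp
      ring
    linarith
  linarith
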